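/- arXiv:1712.08699 — 3 statements merged into one kernel-verified Lean document; each statement's English description precedes it below -/
import Mathlib

section
/- Let n be an odd integer with n ≥ 5. For every positive integer w, (n/(n−1))·2·⌊w/2⌋ ≤ f(w,C_n) ≤ n·⌈w/(n−1)⌉; in particular, if n−1 divides w, then f(w,C_n) = (n/(n−1))·w. -/
/-!  Common definitions: the online token-coloring game of Milans–Wigal. -/

/-- Tokens `i` and `j` of the play `s` (Spoiler's `i`-th move is at vertex `s i`) are
adjacent in the token graph: they are distinct tokens lying on the same vertex or on
adjacent vertices of `G`. -/
def TokenAdj {V : Type*} (G : SimpleGraph V) (s : ℕ → V) (i j : ℕ) : Prop :=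
  i ≠ j ∧ (s i = s j ∨ G.Adj (s i) (s j))

/-- The play consisting of the first `n` tokens of `s` is legal for Spoiler in the game of
width `w`: the token graph on these `n` tokens has chromatic number at most `w`. -/
def LegalPlay {V : Type*} (G : SimpleGraph V) (w : ℕ) (s : ℕ → V) (n : ℕ) : Prop :=
  ∃ φ : ℕ → ℕ, (∀ i, i < n → φ i < w) ∧
    ∀ i j, i < n → j < n → TokenAdj G s i j → φ i ≠ φ j

/-- The color that Algorithm's (deterministic, online) strategy `σ` assigns to the `i`-th
token of the play `s`: `σ` is applied to the history of Spoiler's moves up to and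
including the `i`-th one. -/
def colorOf {V : Type*} (σ : List V → ℕ) (s : ℕ → V) (i : ℕ) : ℕ :=
  σ (List.ofFn fun j : Fin (i + 1) => s j)

/-- Strategy `σ` for Algorithm wins the token game on `G` of width `w` using at most `k`
colors: against every legal Spoiler play, all assigned colors lie in `{0, …, k-1}` and the
resulting coloring of the token graph is proper. -/
def AlgWins {V : Type*} (G : SimpleGraph V) (w k : ℕ) (σ : List V → ℕ) : Prop :=
  ∀ (n : ℕ) (s : ℕ → V), LegalPlay G w s n →
    (∀ i, i < n → colorOf σ s i < k) ∧
    ∀ i j, i < n → j < n → TokenAdj G s i j → colorOf σ s i ≠ colorOf σ s j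

/-- `gameValue G w` is the value `f(w, G)` of the token game on `G` of width `w`: the
minimum number of colors with which Algorithm has a winning strategy. -/
noncomputable def gameValue {V : Type*} (G : SimpleGraph V) (w : ℕ) : ℕ :=
  sInf {k | ∃ σ : List V → ℕ, AlgWins G w k σ}

/-- The tokens at two distinct adjacent vertices form a clique in the token graph. -/
theorem LegalPlay.count_add_count_le {V : Type*} [DecidableEq V] {G : SimpleGraph V} {w N : ℕ}
    {s : ℕ → V} (hs : LegalPlay G w s N) {u v : V} (huv : G.Adj u v) :
    Nat.count (fun j => s j = u) N + Nat.count (fun j => s j = v) N ≤ w := by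
  obtain ⟨φ, hφ, hφ'⟩ := hs
  rw [Nat.count_eq_card_filter_range, Nat.count_eq_card_filter_range,
    ← Finset.card_union_of_disjoint, ← Finset.card_range w]
  · refine Finset.card_le_card_of_injOn φ ?_ ?_
    · intro i hi
      simp only [Finset.coe_union, Finset.coe_filter, Finset.mem_range, Set.mem_union,
        Set.mem_ofPred_eq] at hi
      simp only [Finset.coe_range, Set.mem_Iio]
      exact hφ i (by tauto)
    · intro i hi j hj hij
      simp only [Finset.coe_union, Finset.coe_filter, Finset.mem_range, Set.mem_union,
        Set.mem_ofPred_eq] at hi hj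
      by_contra hne
      refine hφ' i j (by tauto) (by tauto) ⟨hne, ?_⟩ hij
      rcases hi with ⟨-, hi⟩ | ⟨-, hi⟩ <;> rcases hj with ⟨-, hj⟩ | ⟨-, hj⟩ <;>
        simp [hi, hj, huv, huv.symm]
  · rw [Finset.disjoint_left]
    intro i hi hi'
    simp only [Finset.mem_filter] at hi hi'
    exact huv.ne (hi.2.symm.trans hi'.2)

/-- The tokens at a single vertex form a clique in the token graph. -/
theorem LegalPlay.count_le {V : Type*} [DecidableEq V] {G : SimpleGraph V} {w N : ℕ}
    {s : ℕ → V} (hs : LegalPlay G w s N) (v : V) : Nat.count (fun j => s j = v) N ≤ w := by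
  obtain ⟨φ, hφ, hφ'⟩ := hs
  rw [Nat.count_eq_card_filter_range, ← Finset.card_range w]
  refine Finset.card_le_card_of_injOn φ ?_ ?_
  · intro i hi
    simp only [Finset.coe_filter, Finset.mem_range, Set.mem_ofPred_eq] at hi
    simpa using hφ i hi.1
  · intro i hi j hj hij
    simp only [Finset.coe_filter, Finset.mem_range, Set.mem_ofPred_eq] at hi hj
    by_contra hne
    exact hφ' i j hi.1 hj.1 ⟨hne, Or.inl (hi.2.trans hj.2.symm)⟩ hij

/-- The strategy that gives color `c v x` to the token at `v` preceded by `x` others at `v`. -/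
def priorityStrategy {V : Type*} [DecidableEq V] (c : V → ℕ → ℕ) (l : List V) : ℕ :=
  match l.getLast? with
  | none => 0
  | some v => c v (l.count v - 1)

theorem count_ofFn {V : Type*} [DecidableEq V] (s : ℕ → V) (v : V) (i : ℕ) :
    (List.ofFn fun j : Fin i => s j).count v = Nat.count (fun j => s j = v) i := by
  induction i with
  | zero => simp
  | succ i ih =>
    rw [List.ofFn_succ', List.concat_eq_append, List.count_append, Nat.count_succ, ← ih]
    simp [List.count_singleton]

theorem colorOf_priorityStrategy {V : Type*} [DecidableEq V] (c : V → ℕ → ℕ) (s : ℕ → V)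
    (i : ℕ) : colorOf (priorityStrategy c) s i = c (s i) (Nat.count (fun j => s j = s i) i) := by
  have hlast : (List.ofFn fun j : Fin (i + 1) => s j).getLast? = some (s i) := by
    rw [List.ofFn_succ', List.concat_eq_append]
    simp
  unfold colorOf priorityStrategy
  rw [hlast]
  simp [count_ofFn, Nat.count_succ, -List.ofFn_succ]

/-- It suffices to give each vertex a linear order of its colors, such that the initial
segments used by adjacent vertices are disjoint whenever their total length is at most `w`. -/
theorem algWins_priorityStrategy {V : Type*} [DecidableEq V] {G : SimpleGraph V} {w k : ℕ}
    {c : V → ℕ → ℕ} (hlt : ∀ v x, x < w → c v x < k)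
    (hinj : ∀ v x y, x < w → y < w → c v x = c v y → x = y)
    (hadj : ∀ u v x y, G.Adj u v → x + y + 2 ≤ w → c u x ≠ c v y) :
    AlgWins G w k (priorityStrategy c) := by
  intro N s hs
  have hcount : ∀ i, i < N → Nat.count (fun j => s j = s i) i + 1 ≤
      Nat.count (fun j => s j = s i) N := by
    intro i hi
    have := Nat.count_monotone (fun j => s j = s i) (Nat.succ_le_of_lt hi)
    simpa [Nat.count_succ] using this
  have hw : ∀ i, i < N → Nat.count (fun j => s j = s i) i < w := fun i hi =>
    (hcount i hi).trans (hs.count_le (s i))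
  refine ⟨fun i hi => ?_, fun i j hi hj hij => ?_⟩
  · rw [colorOf_priorityStrategy]
    exact hlt _ _ (hw i hi)
  · rw [colorOf_priorityStrategy, colorOf_priorityStrategy]
    obtain ⟨hne, heq | hG⟩ := hij
    · intro h
      have hw' := hw j hj
      rw [← heq] at h hw'
      exact hne (Nat.count_injective (p := fun l => s l = s i) rfl heq.symm
        (hinj _ _ _ (hw i hi) hw' h))
    · have h1 := hcount i hi
      have h2 := hcount j hj
      have h3 := hs.count_add_count_le hG
      exact hadj _ _ _ _ hG (by omega)

theorem cycleGraph_adj_val {n : ℕ} (hn : 2 ≤ n) {u v : Fin n}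
    (h : (SimpleGraph.cycleGraph n).Adj u v) :
    v.val = u.val + 1 ∨ u.val = v.val + 1 ∨ (u.val = 0 ∧ v.val = n - 1) ∨
      (v.val = 0 ∧ u.val = n - 1) := by
  rw [SimpleGraph.cycleGraph_adj'] at h
  have hu := u.isLt
  have hv := v.isLt
  have key : ∀ a b : Fin n, (a - b).val = 1 → a.val = b.val + 1 ∨ (a.val = 0 ∧ b.val = n - 1) := by
    intro a b hab
    have ha := a.isLt
    have hb := b.isLt
    rcases le_or_gt b a with hle | hlt
    · rw [Fin.sub_val_of_le hle] at hab
      have : b.val ≤ a.val := hle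
      omega
    · have : a.val < b.val := hlt
      rw [Fin.val_sub, Nat.mod_eq_of_lt (by omega)] at hab
      omega
  rcases h with h | h
  · rcases key _ _ h with h | h <;> tauto
  · rcases key _ _ h with h | h <;> tauto

/-- In the cyclic sequence `0, n-2, 1, n-3, 2, …, n-1` (for odd `n`), the index of `p`.
Cyclically consecutive entries of the sequence have sum at least `n - 2`. -/
def zigzagIndex (n p : ℕ) : ℕ :=
  if p = n - 1 then n - 1 else if 2 * p ≤ n - 3 then 2 * p else 2 * (n - 2 - p) + 1

/-- The order in which the vertex `v` of the odd cycle uses the `n * t` colors. -/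
def cyclePriority (n t : ℕ) (v : Fin n) (x : ℕ) : ℕ :=
  t * ((zigzagIndex n (x / t) + (n - v)) % n) +
    (if Even (zigzagIndex n (x / t)) then x % t else t - 1 - x % t)

theorem zigzagIndex_lt {n p : ℕ} (hn : 5 ≤ n) (hp : p < n) : zigzagIndex n p < n := by
  unfold zigzagIndex
  split_ifs <;> omega

theorem zigzagIndex_inj {n p q : ℕ} (hodd : Odd n) (hn : 5 ≤ n) (hp : p < n) (hq : q < n)
    (h : zigzagIndex n p = zigzagIndex n q) : p = q := by
  obtain ⟨m, rfl⟩ := hodd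
  unfold zigzagIndex at h
  split_ifs at h <;> omega

theorem zigzagIndex_succ {n p q : ℕ} (hodd : Odd n) (hn : 5 ≤ n) (hp : p < n) (hq : q < n)
    (h : zigzagIndex n q = zigzagIndex n p + 1 ∨
      (zigzagIndex n p = n - 1 ∧ zigzagIndex n q = 0)) :
    n - 1 ≤ p + q ∨ (p + q = n - 2 ∧ (Even (zigzagIndex n p) ↔ ¬ Even (zigzagIndex n q))) := by
  obtain ⟨m, rfl⟩ := hodd
  rw [Nat.even_iff, Nat.even_iff]
  unfold zigzagIndex at h ⊢
  split_ifs at h ⊢ <;> omega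

/-- Splitting a color of `cyclePriority` into its block and its offset in the block. -/
theorem block_offset_inj {t a b r s : ℕ} (hr : r < t) (hs : s < t)
    (h : t * a + r = t * b + s) : a = b ∧ r = s := by
  have ht : 0 < t := by omega
  have h1 := congrArg (· / t) h
  have h2 := congrArg (· % t) h
  simp only [Nat.mul_add_div ht, Nat.mul_add_mod, Nat.div_eq_of_lt hr, Nat.div_eq_of_lt hs,
    Nat.mod_eq_of_lt hr, Nat.mod_eq_of_lt hs] at h1 h2
  omega

theorem add_sub_mod {n i v : ℕ} (hi : i < n) (hv : v < n) :
    (i + (n - v)) % n = if v ≤ i then i - v else i + n - v := by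
  split_ifs with h
  · rw [show i + (n - v) = (i - v) + n by omega, Nat.add_mod_right, Nat.mod_eq_of_lt (by omega)]
  · rw [Nat.mod_eq_of_lt (by omega)]
    omega

theorem offset_lt {t x : ℕ} (ht : 0 < t) (P : Prop) [Decidable P] :
    (if P then x % t else t - 1 - x % t) < t := by
  have := Nat.mod_lt x ht
  split_ifs <;> omega

theorem cyclePriority_lt {n t : ℕ} (hn : 5 ≤ n) (ht : 0 < t) (v : Fin n) (x : ℕ) :
    cyclePriority n t v x < n * t := by
  have h1 : (zigzagIndex n (x / t) + (n - v)) % n < n := Nat.mod_lt _ (by omega)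
  have h2 := offset_lt (x := x) ht (Even (zigzagIndex n (x / t)))
  unfold cyclePriority
  nlinarith

theorem cyclePriority_inj {n t : ℕ} (hodd : Odd n) (hn : 5 ≤ n) (ht : 0 < t) (v : Fin n)
    {x y : ℕ} (hx : x < n * t) (hy : y < n * t)
    (h : cyclePriority n t v x = cyclePriority n t v y) : x = y := by
  have hp := (Nat.div_lt_iff_lt_mul ht).2 hx
  have hq := (Nat.div_lt_iff_lt_mul ht).2 hy
  obtain ⟨h1, h2⟩ := block_offset_inj (offset_lt ht _) (offset_lt ht _) h
  have hi := zigzagIndex_lt hn hp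
  have hj := zigzagIndex_lt hn hq
  have hv := v.isLt
  rw [add_sub_mod hi hv, add_sub_mod hj hv] at h1
  have hij : zigzagIndex n (x / t) = zigzagIndex n (y / t) := by
    split_ifs at h1 <;> omega
  rw [hij] at h2
  have hdiv := zigzagIndex_inj hodd hn hp hq hij
  have hmx := Nat.mod_lt x ht
  have hmy := Nat.mod_lt y ht
  have hmod : x % t = y % t := by
    split_ifs at h2 <;> omega
  rw [← Nat.div_add_mod x t, ← Nat.div_add_mod y t, hdiv, hmod]

theorem cyclePriority_ne_of_succ {n t : ℕ} (hodd : Odd n) (hn : 5 ≤ n) (ht : 0 < t)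
    {u v : Fin n} (huv : v.val = u.val + 1 ∨ (v.val = 0 ∧ u.val = n - 1)) {x y : ℕ}
    (hxy : x + y + 2 ≤ (n - 1) * t) : cyclePriority n t u x ≠ cyclePriority n t v y := by
  intro h
  have hnt : (n - 1) * t ≤ n * t := Nat.mul_le_mul_right _ (by omega)
  have hp := (Nat.div_lt_iff_lt_mul ht).2 (show x < n * t by omega)
  have hq := (Nat.div_lt_iff_lt_mul ht).2 (show y < n * t by omega)
  obtain ⟨h1, h2⟩ := block_offset_inj (offset_lt ht _) (offset_lt ht _) h
  have hi := zigzagIndex_lt hn hp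
  have hj := zigzagIndex_lt hn hq
  have hu := u.isLt
  have hv := v.isLt
  rw [add_sub_mod hi hu, add_sub_mod hj hv] at h1
  have hstep : zigzagIndex n (y / t) = zigzagIndex n (x / t) + 1 ∨
      (zigzagIndex n (x / t) = n - 1 ∧ zigzagIndex n (y / t) = 0) := by
    split_ifs at h1 <;> omega
  have hmx := Nat.mod_lt x ht
  have hmy := Nat.mod_lt y ht
  have hx := Nat.div_add_mod x t
  have hy := Nat.div_add_mod y t
  rcases zigzagIndex_succ hodd hn hp hq hstep with hsum | ⟨hsum, hpar⟩
  · have := Nat.mul_le_mul_left t hsum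
    rw [Nat.mul_add, Nat.mul_comm t (n - 1)] at this
    omega
  · have hoff : x % t + y % t = t - 1 := by
      split_ifs at h2 <;> first | omega | tauto
    have := congrArg (t * ·) hsum
    simp only [Nat.mul_add] at this
    rw [show n - 1 = n - 2 + 1 by omega, Nat.add_mul, Nat.mul_comm (n - 2) t] at hxy
    omega

theorem algWins_cycleGraph {n w t : ℕ} (hodd : Odd n) (hn : 5 ≤ n) (ht : 0 < t)
    (hw : w ≤ (n - 1) * t) :
    AlgWins (SimpleGraph.cycleGraph n) w (n * t) (priorityStrategy (cyclePriority n t)) := by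
  have hnt : (n - 1) * t ≤ n * t := Nat.mul_le_mul_right _ (by omega)
  refine algWins_priorityStrategy (fun v x _ => cyclePriority_lt hn ht v x)
    (fun v x y hx hy h => cyclePriority_inj hodd hn ht v (by omega) (by omega) h) ?_
  intro u v x y hG hxy
  rcases cycleGraph_adj_val (by omega) hG with h | h | h | h
  · exact cyclePriority_ne_of_succ hodd hn ht (Or.inl h) (by omega)
  · exact (cyclePriority_ne_of_succ hodd hn ht (Or.inl h) (by omega)).symm
  · exact (cyclePriority_ne_of_succ hodd hn ht (Or.inr h) (by omega)).symm
  · exact cyclePriority_ne_of_succ hodd hn ht (Or.inr h) (by omega)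

/-- The colors of the `b`-th block of tokens when Spoiler places `h` tokens at each of the
vertices `f 0, f 1, …` in turn. -/
def blockColors {V : Type*} (σ : List V → ℕ) (h : ℕ) (f : ℕ → V) (b : ℕ) : Finset ℕ :=
  (Finset.range h).image fun r => colorOf σ (fun i => f (i / h)) (h * b + r)

theorem blockColors_congr {V : Type*} (σ : List V → ℕ) (h : ℕ) {f g : ℕ → V} {b : ℕ}
    (hfg : ∀ a, a ≤ b → f a = g a) : blockColors σ h f b = blockColors σ h g b := by
  refine Finset.image_congr fun r hr => ?_
  have hr : r < h := by simpa using hr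
  unfold colorOf
  congr 2
  funext j
  refine hfg _ (Nat.lt_succ_iff.1 ((Nat.div_lt_iff_lt_mul (by omega)).2 ?_))
  have := j.isLt
  rw [Nat.succ_mul, Nat.mul_comm b h]
  omega

theorem legalPlay_blocks {V : Type*} {G : SimpleGraph V} {w h B : ℕ} (hw : 2 * h ≤ w)
    {f : ℕ → V} (hf : ∀ a b, a < B → b < B → f a = f b → a = b) {par : ℕ → ℕ}
    (hpar : ∀ a, par a < 2) (hadj : ∀ a b, a < B → b < B → G.Adj (f a) (f b) → par a ≠ par b) :
    LegalPlay G w (fun i => f (i / h)) (B * h) := by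
  rcases Nat.eq_zero_or_pos h with rfl | hpos
  · exact ⟨fun _ => 0, by simp, by simp⟩
  refine ⟨fun i => h * par (i / h) + i % h, fun i _ => ?_, fun i j hi hj hij heq => ?_⟩
  · have h1 := hpar (i / h)
    have h2 := Nat.mod_lt i hpos
    dsimp only
    nlinarith
  · obtain ⟨h1, h2⟩ := block_offset_inj (Nat.mod_lt i hpos) (Nat.mod_lt j hpos) heq
    have hi := (Nat.div_lt_iff_lt_mul hpos).2 hi
    have hj := (Nat.div_lt_iff_lt_mul hpos).2 hj
    obtain ⟨hne, hv | hG⟩ := hij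
    · apply hne
      rw [← Nat.div_add_mod i h, ← Nat.div_add_mod j h, hf _ _ hi hj hv, h2]
    · exact hadj _ _ hi hj hG h1

theorem AlgWins.blockColors_proper {V : Type*} {G : SimpleGraph V} {w k h B : ℕ} {σ : List V → ℕ}
    (hσ : AlgWins G w k σ) (hw : 2 * h ≤ w)
    {f : ℕ → V} (hf : ∀ a b, a < B → b < B → f a = f b → a = b) {par : ℕ → ℕ}
    (hpar : ∀ a, par a < 2) (hadj : ∀ a b, a < B → b < B → G.Adj (f a) (f b) → par a ≠ par b) :
    (∀ b, b < B → blockColors σ h f b ⊆ Finset.range k) ∧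
    (∀ b, b < B → (blockColors σ h f b).card = h) ∧
    ∀ a b, a < B → b < B → G.Adj (f a) (f b) →
      Disjoint (blockColors σ h f a) (blockColors σ h f b) := by
  obtain ⟨hlt, hproper⟩ := hσ _ _ (legalPlay_blocks hw hf hpar hadj)
  have hlt' : ∀ b r, b < B → r < h → h * b + r < B * h := by
    intro b r hb hr
    nlinarith
  have hdiv : ∀ b r, r < h → (h * b + r) / h = b := by
    intro b r hr
    rw [Nat.mul_add_div (by omega), Nat.div_eq_of_lt hr, Nat.add_zero]
  refine ⟨fun b hb => ?_, fun b hb => ?_, fun a b ha hb hG => ?_⟩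
  · intro c hc
    obtain ⟨r, hr, rfl⟩ := Finset.mem_image.1 hc
    exact Finset.mem_range.2 (hlt _ (hlt' b r hb (Finset.mem_range.1 hr)))
  · rw [blockColors, Finset.card_image_of_injOn, Finset.card_range]
    intro r hr r' hr' heq
    have hr : r < h := by simpa using hr
    have hr' : r' < h := by simpa using hr'
    by_contra hne
    refine hproper _ _ (hlt' b r hb hr) (hlt' b r' hb hr') ⟨by omega, Or.inl ?_⟩ heq
    simp only [hdiv b r hr, hdiv b r' hr']
  · rw [Finset.disjoint_left]
    intro c hc hc'
    obtain ⟨r, hr, rfl⟩ := Finset.mem_image.1 hc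
    obtain ⟨r', hr', heq⟩ := Finset.mem_image.1 hc'
    have hr := Finset.mem_range.1 hr
    have hr' := Finset.mem_range.1 hr'
    refine hproper _ _ (hlt' b r' hb hr') (hlt' a r ha hr) ⟨?_, Or.inr ?_⟩ heq
    · intro h0
      have := hdiv a r hr
      rw [← h0, hdiv b r' hr'] at this
      rw [this] at hG
      exact G.irrefl hG
    · simp only [hdiv a r hr, hdiv b r' hr']
      exact hG.symm

/-- Two sets of size `h` inside `k` colors that both avoid a third one of size `h` are close. -/
theorem card_sdiff_add_le {k h : ℕ} {A B C : Finset ℕ} (hA : A ⊆ Finset.range k)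
    (hB : B ⊆ Finset.range k) (hC : C ⊆ Finset.range k) (hB' : B.card = h) (hC' : C.card = h)
    (hAC : Disjoint A C) (hBC : Disjoint B C) : (A \ B).card + 2 * h ≤ k := by
  have h1 : ((A \ B) ∪ B ∪ C).card ≤ k := by
    rw [← Finset.card_range k]
    refine Finset.card_le_card (Finset.union_subset (Finset.union_subset ?_ hB) hC)
    exact Finset.sdiff_subset.trans hA
  rw [Finset.card_union_of_disjoint, Finset.card_union_of_disjoint Finset.sdiff_disjoint] at h1
  · omega
  · rw [Finset.disjoint_union_left]
    exact ⟨hAC.mono_left Finset.sdiff_subset, hBC⟩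

theorem mul_le_mul_of_algWins_cycleGraph {m w k h : ℕ} (hm : 2 ≤ m) (hw : 2 * h ≤ w)
    {σ : List (Fin (2 * m + 1)) → ℕ}
    (hσ : AlgWins (SimpleGraph.cycleGraph (2 * m + 1)) w k σ) :
    h * (2 * m + 1) ≤ m * k := by
  -- Spoiler starts with the vertices `0, 2`, and goes on either with `1` or with `3, …, 2m`.
  let f : ℕ → Fin (2 * m + 1) := fun b =>
    if b = 0 then 0 else if b = 1 then Fin.ofNat _ 2 else Fin.ofNat _ 1
  let g : ℕ → Fin (2 * m + 1) := fun b => if b = 0 then 0 else Fin.ofNat _ (b + 1)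
  have hfv : ∀ b, (f b).val = if b = 0 then 0 else if b = 1 then 2 else 1 := by
    intro b
    dsimp only [f]
    split_ifs
    · rfl
    · exact Nat.mod_eq_of_lt (by omega)
    · exact Nat.mod_eq_of_lt (by omega)
  have hgv : ∀ b, b < 2 * m → (g b).val = if b = 0 then 0 else b + 1 := by
    intro b hb
    dsimp only [g]
    split_ifs
    · rfl
    · exact Nat.mod_eq_of_lt (by omega)
  have hadj : ∀ u v : Fin (2 * m + 1), v.val = u.val + 1 ∨ (v.val = 0 ∧ u.val = 2 * m) →
      (SimpleGraph.cycleGraph (2 * m + 1)).Adj u v := by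
    intro u v huv
    rw [SimpleGraph.cycleGraph_adj']
    right
    have := u.isLt
    have := v.isLt
    rcases huv with huv | huv
    · rw [Fin.sub_val_of_le (Fin.le_def.2 (by omega))]
      omega
    · rw [Fin.val_sub, Nat.mod_eq_of_lt (by omega)]
      omega
  obtain ⟨hf1, hf2, hf3⟩ := hσ.blockColors_proper (B := 3) (f := f) (par := fun b => b / 2 % 2) hw
    (fun a b ha hb hab => by
      have := congrArg Fin.val hab
      rw [hfv, hfv] at this
      split_ifs at this <;> omega)
    (fun a => Nat.mod_lt _ (by omega))
    (fun a b ha hb hG => by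
      have := cycleGraph_adj_val (by omega) hG
      rw [hfv, hfv] at this
      grind)
  obtain ⟨hg1, hg2, hg3⟩ := hσ.blockColors_proper (B := 2 * m) (f := g)
    (par := fun b => if b = 0 then 1 else (b + 1) % 2) hw
    (fun a b ha hb hab => by
      have := congrArg Fin.val hab
      rw [hgv a ha, hgv b hb] at this
      split_ifs at this <;> omega)
    (fun a => by split_ifs <;> omega)
    (fun a b ha hb hG => by
      have := cycleGraph_adj_val (by omega) hG
      rw [hgv a ha, hgv b hb] at this
      by_cases h0 : a = 0 <;> by_cases h0' : b = 0 <;>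
        simp only [h0, h0', if_true, if_false] at this ⊢ <;> omega)
  have h0 : blockColors σ h f 0 = blockColors σ h g 0 := blockColors_congr σ h fun a ha => by
    obtain rfl : a = 0 := by omega
    rfl
  have h1 : blockColors σ h f 1 = blockColors σ h g 1 := blockColors_congr σ h fun a ha => by
    obtain rfl | rfl : a = 0 ∨ a = 1 := by omega
    · rfl
    · rfl
  have hshort : (blockColors σ h g 1 \ blockColors σ h g 0).card + 2 * h ≤ k := by
    rw [← h0, ← h1]
    refine card_sdiff_add_le (hf1 1 (by omega)) (hf1 0 (by omega)) (hf1 2 (by omega))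
      (hf2 0 (by omega)) (hf2 2 (by omega)) (hf3 _ _ (by omega) (by omega) ?_)
      (hf3 _ _ (by omega) (by omega) ?_)
    · exact (hadj _ _ (Or.inl (by simp [hfv]))).symm
    · exact hadj _ _ (Or.inl (by simp [hfv]))
  have hgadj : ∀ b, 1 ≤ b → b + 1 < 2 * m →
      Disjoint (blockColors σ h g b) (blockColors σ h g (b + 1)) := by
    intro b hb hb'
    refine hg3 _ _ (by omega) hb' (hadj _ _ (Or.inl ?_))
    rw [hgv _ hb', hgv b (by omega), if_neg (by omega), if_neg (by omega)]
  have hk : 2 * h ≤ k := by omega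
  have hdrift : ∀ j, j < m →
      (blockColors σ h g 1 \ blockColors σ h g (2 * j + 1)).card ≤ j * (k - 2 * h) := by
    intro j
    induction j with
    | zero => simp
    | succ j ih =>
      intro hj
      have hstep := card_sdiff_add_le (hg1 (2 * j + 1) (by omega)) (hg1 (2 * j + 3) (by omega))
        (hg1 (2 * j + 2) (by omega)) (hg2 _ (by omega)) (hg2 _ (by omega))
        (hgadj (2 * j + 1) (by omega) (by omega)) (hgadj (2 * j + 2) (by omega) (by omega)).symm
      have hsub := (Finset.card_le_card (sdiff_triangle (blockColors σ h g 1)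
        (blockColors σ h g (2 * j + 1)) (blockColors σ h g (2 * j + 3)))).trans
        (Finset.card_union_le _ _)
      have := ih (by omega)
      rw [show 2 * (j + 1) + 1 = 2 * j + 3 by ring, Nat.succ_mul j]
      omega
  have hlast : Disjoint (blockColors σ h g (2 * (m - 1) + 1)) (blockColors σ h g 0) := by
    refine hg3 _ _ (by omega) (by omega) (hadj _ _ (Or.inr ?_))
    rw [hgv _ (by omega), hgv _ (by omega), if_pos rfl, if_neg (by omega)]
    omega
  have hlong : (blockColors σ h g 1 ∩ blockColors σ h g 0).card ≤ (m - 1) * (k - 2 * h) := by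
    refine (Finset.card_le_card ?_).trans (hdrift (m - 1) (by omega))
    intro c hc
    rw [Finset.mem_inter] at hc
    exact Finset.mem_sdiff.2 ⟨hc.1, fun hc' => Finset.disjoint_left.1 hlast hc' hc.2⟩
  have hsum := Finset.card_sdiff_add_card_inter (blockColors σ h g 1) (blockColors σ h g 0)
  rw [hg2 1 (by omega)] at hsum
  obtain ⟨d, rfl⟩ := Nat.exists_eq_add_of_le hk
  obtain ⟨l, rfl⟩ := Nat.exists_eq_add_of_le' (show 1 ≤ m by omega)
  simp only [Nat.add_sub_cancel_left, Nat.add_sub_cancel] at hlong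
  have : h ≤ (l + 1) * d := by
    rw [Nat.succ_mul]
    omega
  nlinarith

/-- Odd holes. Let `n` be odd with `n ≥ 5`.  For every positive integer `w`,
`(n/(n-1)) · 2⌊w/2⌋ ≤ f(w, Cₙ) ≤ n · ⌈w/(n-1)⌉`; in particular, if `n - 1` divides `w`,
then `f(w, Cₙ) = (n/(n-1)) · w`. -/
theorem gameValue_cycleGraph (n : ℕ) (hodd : Odd n) (hn : 5 ≤ n) (w : ℕ) (hw : 0 < w) :
    (((n : ℚ) / ((n : ℚ) - 1)) * (2 * ((w / 2 : ℕ) : ℚ)) ≤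
        (gameValue (SimpleGraph.cycleGraph n) w : ℚ) ∧
      (gameValue (SimpleGraph.cycleGraph n) w : ℚ) ≤
        (n : ℚ) * (⌈(w : ℚ) / ((n : ℚ) - 1)⌉ : ℚ)) ∧
    ((n - 1) ∣ w →
      (gameValue (SimpleGraph.cycleGraph n) w : ℚ) = ((n : ℚ) / ((n : ℚ) - 1)) * w) := by
  have hn1 : (0 : ℚ) < (n : ℚ) - 1 := by
    have : (5 : ℚ) ≤ n := by exact_mod_cast hn
    linarith
  set t : ℕ := ⌈(w : ℚ) / ((n : ℚ) - 1)⌉₊ with ht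
  have hceil : ((⌈(w : ℚ) / ((n : ℚ) - 1)⌉ : ℤ) : ℚ) = t := by
    rw [ht, natCast_ceil_eq_intCast_ceil (by positivity)]
  have htpos : 0 < t := Nat.ceil_pos.2 (by positivity)
  have hwt : w ≤ (n - 1) * t := by
    have h : (w : ℚ) / ((n : ℚ) - 1) ≤ t := Nat.le_ceil _
    rw [div_le_iff₀ hn1] at h
    have h' : (w : ℚ) ≤ ((n - 1 : ℕ) : ℚ) * t := by
      rw [Nat.cast_sub (by omega)]
      push_cast
      linarith
    exact_mod_cast h'
  have hwin := algWins_cycleGraph hodd hn htpos hwt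
  have hle : gameValue (SimpleGraph.cycleGraph n) w ≤ n * t := Nat.sInf_le ⟨_, hwin⟩
  obtain ⟨σ, hσ⟩ : ∃ σ, AlgWins (SimpleGraph.cycleGraph n) w
      (gameValue (SimpleGraph.cycleGraph n) w) σ :=
    Nat.sInf_mem (s := {k | ∃ σ, AlgWins (SimpleGraph.cycleGraph n) w k σ}) ⟨_, _, hwin⟩
  have hlower : ((n : ℚ) / ((n : ℚ) - 1)) * (2 * ((w / 2 : ℕ) : ℚ)) ≤
      (gameValue (SimpleGraph.cycleGraph n) w : ℚ) := by
    obtain ⟨m, rfl⟩ := hodd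
    have key := mul_le_mul_of_algWins_cycleGraph (h := w / 2) (by omega) (by omega) hσ
    have key' : ((w / 2 : ℕ) : ℚ) * (2 * m + 1) ≤
        m * (gameValue (SimpleGraph.cycleGraph (2 * m + 1)) w : ℚ) := by exact_mod_cast key
    rw [div_mul_eq_mul_div, div_le_iff₀ hn1]
    push_cast at key' ⊢
    linarith
  have hupper : (gameValue (SimpleGraph.cycleGraph n) w : ℚ) ≤
      (n : ℚ) * (⌈(w : ℚ) / ((n : ℚ) - 1)⌉ : ℚ) := by
    rw [hceil]
    exact_mod_cast hle
  refine ⟨⟨hlower, hupper⟩, fun hdvd => le_antisymm ?_ ?_⟩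
  · obtain ⟨q, rfl⟩ := hdvd
    have hcast : (((n - 1) * q : ℕ) : ℚ) = ((n : ℚ) - 1) * q := by
      rw [Nat.cast_mul, Nat.cast_sub (by omega)]
      simp
    rw [hcast, mul_div_cancel_left₀ _ hn1.ne', Int.ceil_natCast] at hupper
    rw [hcast, ← mul_assoc, div_mul_cancel₀ _ hn1.ne']
    exact_mod_cast hupper
  · have heven : 2 ∣ w := by
      obtain ⟨m, rfl⟩ := hodd
      exact (Dvd.intro m (by simp)).trans hdvd
    have h2 : (2 : ℚ) * ((w / 2 : ℕ) : ℚ) = w := by exact_mod_cast Nat.mul_div_cancel' heven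
    rwa [h2] at hlower
end

section
/- For every positive integer w, (5/2)·⌊w/2⌋ ≤ f(w,P_5^2) ≤ (5w+2)/4; consequently, when w is even, f(w,P_5^2) = ⌈(5/4)·w⌉. -/
/-- `P₅²`: the square (distance-2 power) of the path on 5 vertices: vertices `0,…,4`,
adjacent iff distinct and at distance at most 2 along the path. -/
def P5sq : SimpleGraph (Fin 5) :=
  SimpleGraph.fromRel (fun i j : Fin 5 => i.val ≤ j.val + 2 ∧ j.val ≤ i.val + 2)

theorem P5sq_adj {i j : Fin 5} :
    P5sq.Adj i j ↔ i ≠ j ∧ i.val ≤ j.val + 2 ∧ j.val ≤ i.val + 2 := by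
  simp only [P5sq, SimpleGraph.fromRel_adj]
  tauto

theorem colorOf_congr {V : Type*} (σ : List V → ℕ) {s t : ℕ → V} {i : ℕ}
    (h : ∀ j ≤ i, s j = t j) : colorOf σ s i = colorOf σ t i := by
  unfold colorOf
  congr 2
  funext j
  exact h j (Nat.lt_succ_iff.mp j.isLt)

/-- In a legal play, a clique of `G` receives at most `w` tokens. -/
theorem LegalPlay.card_tokens_le {V : Type*} [DecidableEq V] {G : SimpleGraph V} {w n : ℕ}
    {s : ℕ → V} (h : LegalPlay G w s n) {S : Finset V} (hS : G.IsClique (S : Set V)) :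
    ∑ v ∈ S, ((Finset.range n).filter (s · = v)).card ≤ w := by
  obtain ⟨φ, hφ, hne⟩ := h
  have key : ((Finset.range n).filter (s · ∈ S)).card ≤ (Finset.range w).card := by
    refine Finset.card_le_card_of_injOn φ ?_ ?_
    · intro i hi
      simp only [Finset.coe_filter, Finset.mem_range, Set.mem_ofPred_eq] at hi
      simpa using hφ i hi.1
    · intro i hi j hj hij
      simp only [Finset.coe_filter, Finset.mem_range, Set.mem_ofPred_eq] at hi hj
      by_contra hne'
      refine hne i j hi.1 hj.1 ⟨hne', ?_⟩ hij
      by_cases hs : s i = s j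
      · exact Or.inl hs
      · exact Or.inr (hS hi.2 hj.2 hs)
  rw [Finset.card_range] at key
  refine le_trans (le_of_eq ?_) key
  rw [Finset.card_eq_sum_card_fiberwise (s := (Finset.range n).filter (s · ∈ S)) (f := s)
    (t := S) (fun i hi => (Finset.mem_filter.mp hi).2)]
  refine Finset.sum_congr rfl fun v hv => ?_
  congr 1
  ext i
  simp only [Finset.mem_filter]
  constructor
  · rintro ⟨h1, rfl⟩
    exact ⟨⟨h1, hv⟩, rfl⟩
  · rintro ⟨⟨h1, -⟩, h2⟩
    exact ⟨h1, h2⟩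

/-- If Algorithm can always color the next token while maintaining an invariant of the sets of
colors used on the vertices, and the invariant bounds the colors in every legal position, then
Algorithm has a winning strategy. -/
theorem exists_algWins_of_invariant {V : Type*} [DecidableEq V] (G : SimpleGraph V) (w k : ℕ)
    (I : (V → Finset ℕ) → Prop) (h_init : I fun _ => ∅)
    (h_step : ∀ C, I C → ∀ v, ∃ c, (∀ u, u = v ∨ G.Adj u v → c ∉ C u) ∧
      I (Function.update C v (insert c (C v))))
    (h_bound : ∀ C, I C →
      (∀ S : Finset V, G.IsClique (S : Set V) → ∑ v ∈ S, (C v).card ≤ w) →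
      ∀ v, ∀ c ∈ C v, c < k) :
    ∃ σ, AlgWins G w k σ := by
  have h_step' : ∀ C v, ∃ c, I C → (∀ u, u = v ∨ G.Adj u v → c ∉ C u) ∧
      I (Function.update C v (insert c (C v))) := by
    intro C v
    by_cases hC : I C
    · obtain ⟨c, hc⟩ := h_step C hC v
      exact ⟨c, fun _ => hc⟩
    · exact ⟨0, fun h => absurd h hC⟩
  choose col hcol using h_step'
  let next : (V → Finset ℕ) → V → (V → Finset ℕ) :=
    fun C v => Function.update C v (insert (col C v) (C v))
  let pos : List V → (V → Finset ℕ) := fun l => l.foldl next fun _ => ∅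
  let σ : List V → ℕ := fun l => l.getLast?.elim 0 (col (pos l.dropLast))
  let st : (ℕ → V) → ℕ → (V → Finset ℕ) := fun s n => pos (List.ofFn fun j : Fin n => s j)
  have ofFn_succ : ∀ (s : ℕ → V) n, (List.ofFn fun j : Fin (n + 1) => s j) =
      (List.ofFn fun j : Fin n => s j) ++ [s n] := by
    intro s n
    rw [List.ofFn_succ_last]
    simp
  have st_succ : ∀ s n, st s (n + 1) = next (st s n) (s n) := by
    intro s n
    simp only [st, pos, ofFn_succ, List.foldl_append, List.foldl_cons, List.foldl_nil]
  have colorOf_eq : ∀ s n, colorOf σ s n = col (st s n) (s n) := by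
    intro s n
    simp only [colorOf, ofFn_succ, σ, st, List.getLast?_concat, List.dropLast_concat,
      Option.elim_some]
  have st_inv : ∀ s n, I (st s n) := by
    intro s n
    induction n with
    | zero => simpa [st, pos] using h_init
    | succ n ih =>
      rw [st_succ]
      exact (hcol _ _ ih).2
  have st_mem : ∀ s n i, i < n → colorOf σ s i ∈ st s n (s i) := by
    intro s n i hi
    induction n with
    | zero => omega
    | succ n ih =>
      rw [st_succ]
      rcases Nat.lt_succ_iff_lt_or_eq.mp hi with h | rfl
      · by_cases hs : s i = s n
        · have := ih h
          rw [hs] at this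
          simp [next, hs, this]
        · simpa [next, Function.update_of_ne hs] using ih h
      · simp [next, colorOf_eq]
  have st_card : ∀ s n v, (st s n v).card ≤ ((Finset.range n).filter (s · = v)).card := by
    intro s n v
    induction n with
    | zero => simp [st, pos]
    | succ n ih =>
      rw [st_succ, Finset.range_add_one, Finset.filter_insert]
      by_cases hs : s n = v
      · subst hs
        rw [if_pos rfl, Finset.card_insert_of_notMem (by simp)]
        simp only [next, Function.update_self]
        exact (Finset.card_insert_le _ _).trans (by omega)
      · rw [if_neg hs]
        simpa [next, Function.update_of_ne (Ne.symm hs)] using ih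
  have st_ne : ∀ s i j, i < j → (s i = s j ∨ G.Adj (s i) (s j)) →
      colorOf σ s i ≠ colorOf σ s j := by
    intro s i j hij hadj heq
    refine (hcol (st s j) (s j) (st_inv s j)).1 (s i) hadj ?_
    rw [← colorOf_eq, ← heq]
    exact st_mem s j i hij
  refine ⟨σ, fun n s hs => ⟨fun i hi => ?_, fun i j _ _ hadj => ?_⟩⟩
  · refine h_bound (st s n) (st_inv s n) (fun S hS => ?_) (s i) _ (st_mem s n i hi)
    exact (Finset.sum_le_sum fun v _ => st_card s n v).trans (hs.card_tokens_le hS)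
  · rcases lt_or_gt_of_ne hadj.1 with h | h
    · exact st_ne s i j h hadj.2
    · exact (st_ne s j i h (hadj.2.imp Eq.symm fun h => h.symm)).symm

/-- The positions maintained by Algorithm on `P5sq`, where `C v` is the set of colors on `v` and
all colors are below `T`. A token at an end of the path is paired with a token at the second
vertex from the other end whenever possible, and with a token at the other end only if otherwise
more than `q` tokens at either end would be unpaired. -/
structure PairingInvariant (q : ℕ) (C : Fin 5 → Finset ℕ) (T : ℕ) : Prop where
  disjoint : ∀ u v, P5sq.Adj u v → Disjoint (C u) (C v)
  lt : ∀ v, ∀ c ∈ C v, c < T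
  total : T + (C 0 ∩ C 4).card + (C 0 ∩ C 3).card + (C 1 ∩ C 4).card =
    (C 0).card + (C 1).card + (C 2).card + (C 3).card + (C 4).card
  le_zero : (C 0 ∩ C 4).card + (C 0 ∩ C 3).card ≤ (C 0).card
  le_four : (C 0 ∩ C 4).card + (C 1 ∩ C 4).card ≤ (C 4).card
  le_one : (C 1 ∩ C 4).card ≤ (C 1).card
  le_three : (C 0 ∩ C 3).card ≤ (C 3).card
  paired_left : (C 0).card = (C 0 ∩ C 4).card + (C 0 ∩ C 3).card ∨
    (C 3).card = (C 0 ∩ C 3).card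
  paired_right : (C 4).card = (C 0 ∩ C 4).card + (C 1 ∩ C 4).card ∨
    (C 1).card = (C 1 ∩ C 4).card
  unpaired_ends : (C 0).card ≤ (C 0 ∩ C 4).card + (C 0 ∩ C 3).card + q ∨
    (C 4).card ≤ (C 0 ∩ C 4).card + (C 1 ∩ C 4).card + q
  paired_ends : (C 0 ∩ C 4).card ≤ q ∨
    (q + (C 0 ∩ C 4).card ≤ (C 0).card ∧ q + (C 0 ∩ C 4).card ≤ (C 4).card)

namespace PairingInvariant

variable {q : ℕ} {C : Fin 5 → Finset ℕ} {T : ℕ}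

theorem empty (q : ℕ) : PairingInvariant q (fun _ => ∅) 0 := by
  constructor <;> simp

/-- Reversing the path preserves the invariant. -/
theorem rev (h : PairingInvariant q C T) : PairingInvariant q (C ∘ Fin.rev) T := by
  have e0 : Fin.rev (0 : Fin 5) = 4 := rfl
  have e1 : Fin.rev (1 : Fin 5) = 3 := rfl
  have e2 : Fin.rev (2 : Fin 5) = 2 := rfl
  have e3 : Fin.rev (3 : Fin 5) = 1 := rfl
  have e4 : Fin.rev (4 : Fin 5) = 0 := rfl
  obtain ⟨h1, h2, h3, h4, h5, h6, h7, h8, h9, h10, h11⟩ := h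
  refine ⟨fun u v huv => h1 _ _ ?_, fun v => h2 _, ?_, ?_, ?_, ?_, ?_, ?_, ?_, ?_, ?_⟩
  · rw [P5sq_adj] at huv ⊢
    refine ⟨fun h => huv.1 (Fin.rev_injective h), ?_⟩
    simp only [Fin.val_rev]
    omega
  all_goals
    simp only [Function.comp, e0, e1, e2, e3, e4, Finset.inter_comm (C 4),
      Finset.inter_comm (C 3) (C 0)]
    omega

/-- The color `c` may be given to a token at `v`, maintaining the invariant. -/
def Extends (q : ℕ) (C : Fin 5 → Finset ℕ) (v : Fin 5) (c : ℕ) : Prop :=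
  (∀ u, u = v ∨ P5sq.Adj u v → c ∉ C u) ∧
    ∃ T, PairingInvariant q (Function.update C v (insert c (C v))) T

theorem Extends.rev {v : Fin 5} {c : ℕ} (h : Extends q (C ∘ Fin.rev) v c) :
    Extends q C (Fin.rev v) c := by
  obtain ⟨h1, T, h2⟩ := h
  refine ⟨fun u hu => ?_, T, ?_⟩
  · have := h1 (Fin.rev u) ?_
    · simpa using this
    · rcases hu with rfl | hu
      · simp
      · right
        rw [P5sq_adj] at hu ⊢
        refine ⟨fun h => hu.1 (by rw [← h, Fin.rev_rev]), ?_⟩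
        have := hu.2
        simp only [Fin.val_rev] at this ⊢
        omega
  · convert h2.rev using 1
    funext u
    by_cases hu : u = Fin.rev v
    · subst hu
      simp
    · have : Fin.rev u ≠ v := fun h => hu (by rw [← h, Fin.rev_rev])
      simp [Function.update_of_ne hu, Function.update_of_ne this]

theorem disjoint_update (h : PairingInvariant q C T) {v : Fin 5} {c : ℕ}
    (hc : ∀ u, u = v ∨ P5sq.Adj u v → c ∉ C u) (a b : Fin 5) (hab : P5sq.Adj a b) :
    Disjoint (Function.update C v (insert c (C v)) a)
      (Function.update C v (insert c (C v)) b) := by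
  have hd := h.disjoint a b hab
  by_cases ha : a = v
  · subst ha
    have hb : b ≠ a := hab.ne.symm
    rw [Function.update_self, Function.update_of_ne hb, Finset.disjoint_insert_left]
    exact ⟨hc b (Or.inr hab.symm), hd⟩
  · rw [Function.update_of_ne ha]
    by_cases hb : b = v
    · subst hb
      rw [Function.update_self, Finset.disjoint_insert_right]
      exact ⟨hc a (Or.inr hab), hd⟩
    · rwa [Function.update_of_ne hb]

theorem lt_update (h : PairingInvariant q C T) {v : Fin 5} {c T' : ℕ} (hT : T ≤ T')
    (hc : c < T') (u : Fin 5) : ∀ d ∈ Function.update C v (insert c (C v)) u, d < T' := by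
  intro d hd
  by_cases hu : u = v
  · subst hu
    rw [Function.update_self, Finset.mem_insert] at hd
    rcases hd with rfl | hd
    · exact hc
    · exact (h.lt u d hd).trans_le hT
  · rw [Function.update_of_ne hu] at hd
    exact (h.lt u d hd).trans_le hT

theorem notMem (h : PairingInvariant q C T) (v : Fin 5) : T ∉ C v :=
  fun hT => (h.lt v T hT).false

theorem extends_two (h : PairingInvariant q C T) : ∃ c, Extends q C 2 c := by
  have hc : ∀ u, u = 2 ∨ P5sq.Adj u 2 → T ∉ C u := fun u _ => h.notMem u
  refine ⟨T, hc, T + 1, h.disjoint_update hc, h.lt_update (by omega) (by omega),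
    ?_, ?_, ?_, ?_, ?_, ?_, ?_, ?_, ?_⟩
  all_goals
    obtain ⟨-, -, h3, h4, h5, h6, h7, h8, h9, h10, h11⟩ := h
    simp [Function.update, Finset.card_insert_of_notMem, hc]
    omega

theorem extends_zero_fresh (h : PairingInvariant q C T)
    (h3 : (C 3).card = (C 0 ∩ C 3).card)
    (h4 : (C 0).card + 1 ≤ (C 0 ∩ C 4).card + (C 0 ∩ C 3).card + q ∨
      (C 4).card ≤ (C 0 ∩ C 4).card + (C 1 ∩ C 4).card + q) : Extends q C 0 T := by
  have hn := h.notMem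
  have hc : ∀ u, u = 0 ∨ P5sq.Adj u 0 → T ∉ C u := fun u _ => h.notMem u
  refine ⟨hc, T + 1, h.disjoint_update hc, h.lt_update (by omega) (by omega),
    ?_, ?_, ?_, ?_, ?_, ?_, ?_, ?_, ?_⟩
  all_goals
    obtain ⟨-, -, h3, h4, h5, h6, h7, h8, h9, h10, h11⟩ := h
    simp [Function.update, Finset.card_insert_of_notMem, Finset.insert_inter_of_notMem, hn]
    omega

theorem extends_zero_of_mem_three (h : PairingInvariant q C T) {c : ℕ} (h3 : c ∈ C 3)
    (h0 : c ∉ C 0) : Extends q C 0 c := by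
  have h1 : c ∉ C 1 := fun h' => Finset.disjoint_left.mp
    (h.disjoint 1 3 (by rw [P5sq_adj]; decide)) h' h3
  have h2 : c ∉ C 2 := fun h' => Finset.disjoint_left.mp
    (h.disjoint 2 3 (by rw [P5sq_adj]; decide)) h' h3
  have h4 : c ∉ C 4 := fun h' => Finset.disjoint_left.mp
    (h.disjoint 4 3 (by rw [P5sq_adj]; decide)) h' h3
  have hc : ∀ u, u = 0 ∨ P5sq.Adj u 0 → c ∉ C u := by
    intro u hu
    rw [P5sq_adj] at hu
    fin_cases u <;> first | assumption | (exfalso; revert hu; decide)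
  have hlt : (C 0 ∩ C 3).card < (C 3).card := by
    refine Finset.card_lt_card ⟨Finset.inter_subset_right, fun hs => h0 ?_⟩
    exact (Finset.mem_inter.mp (hs h3)).1
  refine ⟨hc, T, h.disjoint_update hc, h.lt_update le_rfl (h.lt 3 c h3),
    ?_, ?_, ?_, ?_, ?_, ?_, ?_, ?_, ?_⟩
  all_goals
    obtain ⟨-, -, i3, i4, i5, i6, i7, i8, i9, i10, i11⟩ := h
    simp [Function.update, Finset.card_insert_of_notMem, Finset.insert_inter_of_notMem,
      Finset.insert_inter_of_mem, h0, h3, h4]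
    omega

theorem extends_zero_of_mem_four (h : PairingInvariant q C T) {c : ℕ} (h4 : c ∈ C 4)
    (h0 : c ∉ C 0) (h1 : c ∉ C 1) (hC3 : (C 3).card = (C 0 ∩ C 3).card)
    (hC0 : (C 0 ∩ C 4).card + (C 0 ∩ C 3).card + q ≤ (C 0).card)
    (hC4 : (C 0 ∩ C 4).card + (C 1 ∩ C 4).card + q < (C 4).card) : Extends q C 0 c := by
  have h2 : c ∉ C 2 := fun h' => Finset.disjoint_left.mp
    (h.disjoint 2 4 (by rw [P5sq_adj]; decide)) h' h4
  have h3 : c ∉ C 3 := fun h' => Finset.disjoint_left.mp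
    (h.disjoint 3 4 (by rw [P5sq_adj]; decide)) h' h4
  have hc : ∀ u, u = 0 ∨ P5sq.Adj u 0 → c ∉ C u := by
    intro u hu
    rw [P5sq_adj] at hu
    fin_cases u <;> first | assumption | (exfalso; revert hu; decide)
  refine ⟨hc, T, h.disjoint_update hc, h.lt_update le_rfl (h.lt 4 c h4),
    ?_, ?_, ?_, ?_, ?_, ?_, ?_, ?_, ?_⟩
  all_goals
    obtain ⟨-, -, i3, i4, i5, i6, i7, i8, i9, i10, i11⟩ := h
    simp [Function.update, Finset.card_insert_of_notMem, Finset.insert_inter_of_notMem,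
      Finset.insert_inter_of_mem, h0, h3, h4]
    omega

theorem extends_zero (h : PairingInvariant q C T) : ∃ c, Extends q C 0 c := by
  by_cases h3 : C 3 ⊆ C 0
  · have hC3 : (C 3).card = (C 0 ∩ C 3).card := by rw [Finset.inter_eq_right.mpr h3]
    by_cases hq : (C 0).card + 1 ≤ (C 0 ∩ C 4).card + (C 0 ∩ C 3).card + q ∨
      (C 4).card ≤ (C 0 ∩ C 4).card + (C 1 ∩ C 4).card + q
    · exact ⟨T, h.extends_zero_fresh hC3 hq⟩
    · have hlt : ((C 0 ∩ C 4) ∪ (C 1 ∩ C 4)).card < (C 4).card :=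
        (Finset.card_union_le _ _).trans_lt (by omega)
      obtain ⟨c, hc, hc'⟩ := Finset.exists_mem_notMem_of_card_lt_card hlt
      simp only [Finset.mem_union, Finset.mem_inter, hc, and_true, not_or] at hc'
      exact ⟨c, h.extends_zero_of_mem_four hc hc'.1 hc'.2 hC3 (by omega) (by omega)⟩
  · obtain ⟨c, hc, hc'⟩ := Finset.not_subset.mp h3
    exact ⟨c, h.extends_zero_of_mem_three hc hc'⟩

theorem extends_three_of_mem_zero (h : PairingInvariant q C T) {c : ℕ} (h0 : c ∈ C 0)
    (h3 : c ∉ C 3) (h4 : c ∉ C 4)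
    (hC0 : (C 0 ∩ C 4).card + (C 0 ∩ C 3).card < (C 0).card) : Extends q C 3 c := by
  have h1 : c ∉ C 1 := fun h' => Finset.disjoint_left.mp
    (h.disjoint 1 0 (by rw [P5sq_adj]; decide)) h' h0
  have h2 : c ∉ C 2 := fun h' => Finset.disjoint_left.mp
    (h.disjoint 2 0 (by rw [P5sq_adj]; decide)) h' h0
  have hc : ∀ u, u = 3 ∨ P5sq.Adj u 3 → c ∉ C u := by
    intro u hu
    rw [P5sq_adj] at hu
    fin_cases u <;> first | assumption | (exfalso; revert hu; decide)
  refine ⟨hc, T, h.disjoint_update hc, h.lt_update le_rfl (h.lt 0 c h0),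
    ?_, ?_, ?_, ?_, ?_, ?_, ?_, ?_, ?_⟩
  all_goals
    obtain ⟨-, -, i3, i4, i5, i6, i7, i8, i9, i10, i11⟩ := h
    simp [Function.update, Finset.card_insert_of_notMem, Finset.inter_insert_of_mem, h0, h3]
    omega

theorem extends_three_fresh (h : PairingInvariant q C T)
    (hC0 : (C 0).card = (C 0 ∩ C 4).card + (C 0 ∩ C 3).card) : Extends q C 3 T := by
  have hn := h.notMem
  have hc : ∀ u, u = 3 ∨ P5sq.Adj u 3 → T ∉ C u := fun u _ => h.notMem u
  refine ⟨hc, T + 1, h.disjoint_update hc, h.lt_update (by omega) (by omega),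
    ?_, ?_, ?_, ?_, ?_, ?_, ?_, ?_, ?_⟩
  all_goals
    obtain ⟨-, -, h3, h4, h5, h6, h7, h8, h9, h10, h11⟩ := h
    simp [Function.update, Finset.card_insert_of_notMem, Finset.inter_insert_of_notMem, hn]
    omega

theorem extends_three (h : PairingInvariant q C T) : ∃ c, Extends q C 3 c := by
  by_cases hlt : (C 0 ∩ C 4).card + (C 0 ∩ C 3).card < (C 0).card
  · obtain ⟨c, hc, hc'⟩ := Finset.exists_mem_notMem_of_card_lt_card
      ((Finset.card_union_le (C 0 ∩ C 4) (C 0 ∩ C 3)).trans_lt hlt)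
    simp only [Finset.mem_union, Finset.mem_inter, hc, true_and, not_or] at hc'
    exact ⟨c, h.extends_three_of_mem_zero hc hc'.2 hc'.1 hlt⟩
  · exact ⟨T, h.extends_three_fresh (by have := h.le_zero; omega)⟩

theorem exists_extends (h : PairingInvariant q C T) (v : Fin 5) : ∃ c, Extends q C v c := by
  fin_cases v
  · exact h.extends_zero
  · exact h.rev.extends_three.imp fun _ hc => hc.rev
  · exact h.extends_two
  · exact h.extends_three
  · exact h.rev.extends_zero.imp fun _ hc => hc.rev

theorem size_le {w : ℕ} (h : PairingInvariant ((w + 2) / 4) C T)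
    (hl : (C 0).card + (C 1).card + (C 2).card ≤ w)
    (hm : (C 1).card + (C 2).card + (C 3).card ≤ w)
    (hr : (C 2).card + (C 3).card + (C 4).card ≤ w) : T ≤ (5 * w + 2) / 4 := by
  obtain ⟨-, -, h3, h4, h5, h6, h7, h8, h9, h10, h11⟩ := h
  omega

end PairingInvariant

theorem exists_algWins_P5sq (w : ℕ) : ∃ σ, AlgWins P5sq w ((5 * w + 2) / 4) σ := by
  refine exists_algWins_of_invariant P5sq w _
    (fun C => ∃ T, PairingInvariant ((w + 2) / 4) C T) ⟨0, .empty _⟩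
    (fun C ⟨T, h⟩ v => h.exists_extends v) ?_
  rintro C ⟨T, h⟩ hcl v c hc
  refine (h.lt v c hc).trans_le (h.size_le ?_ ?_ ?_)
  · have := hcl {0, 1, 2} (by
      intro a ha b hb hab
      rw [P5sq_adj]
      revert a b
      decide)
    simpa [add_assoc] using this
  · have := hcl {1, 2, 3} (by
      intro a ha b hb hab
      rw [P5sq_adj]
      revert a b
      decide)
    simpa [add_assoc] using this
  · have := hcl {2, 3, 4} (by
      intro a ha b hb hab
      rw [P5sq_adj]
      revert a b
      decide)
    simpa [add_assoc] using this

/-- Spoiler plays `m` tokens on each of the vertices `0`, `4`, and then on `a` and on `b`. -/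
def blockPlay (m : ℕ) (a b : Fin 5) (j : ℕ) : Fin 5 :=
  if j < m then 0 else if j < 2 * m then 4 else if j < 3 * m then a else b

theorem legalPlay_blockPlay_center {m w : ℕ} (h : 2 * m ≤ w) :
    LegalPlay P5sq w (blockPlay m 2 2) (3 * m) := by
  refine ⟨fun j => if j < m then j else j - m, fun i hi => ?_, fun i j hi hj hij => ?_⟩
  · dsimp only
    split_ifs <;> omega
  · obtain ⟨hne, hadj⟩ := hij
    rw [P5sq_adj] at hadj
    dsimp only
    unfold blockPlay at hadj
    split_ifs at hadj ⊢ <;> omega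

theorem legalPlay_blockPlay_sides {m w : ℕ} (h : 2 * m ≤ w) :
    LegalPlay P5sq w (blockPlay m 1 3) (4 * m) := by
  refine ⟨fun j => if j < 2 * m then j else if j < 3 * m then j - m else j - 3 * m,
    fun i hi => ?_, fun i j hi hj hij => ?_⟩
  · dsimp only
    split_ifs <;> omega
  · obtain ⟨hne, hadj⟩ := hij
    rw [P5sq_adj] at hadj
    dsimp only
    unfold blockPlay at hadj
    split_ifs at hadj ⊢ <;> omega

/-- The colors used by `σ` on the tokens `a, …, b - 1` of the play `s`. -/
def colorsOn {V : Type*} (σ : List V → ℕ) (s : ℕ → V) (a b : ℕ) : Finset ℕ :=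
  (Finset.Ico a b).image (colorOf σ s)

section AlgWins

variable {V : Type*} {G : SimpleGraph V} {w k n : ℕ} {σ : List V → ℕ} {s : ℕ → V}

theorem AlgWins.colorsOn_subset (h : AlgWins G w k σ) (hs : LegalPlay G w s n) {a b : ℕ}
    (hb : b ≤ n) : colorsOn σ s a b ⊆ Finset.range k := by
  intro c hc
  obtain ⟨i, hi, rfl⟩ := Finset.mem_image.mp hc
  rw [Finset.mem_Ico] at hi
  exact Finset.mem_range.mpr ((h n s hs).1 i (by omega))

theorem AlgWins.card_colorsOn (h : AlgWins G w k σ) (hs : LegalPlay G w s n) {a b : ℕ}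
    (hb : b ≤ n) (v : V) (hv : ∀ i ∈ Finset.Ico a b, s i = v) :
    (colorsOn σ s a b).card = b - a := by
  rw [colorsOn, Finset.card_image_of_injOn, Nat.card_Ico]
  intro i hi j hj hij
  by_contra hne
  have hi' := Finset.mem_Ico.mp hi
  have hj' := Finset.mem_Ico.mp hj
  exact (h n s hs).2 i j (by omega) (by omega)
    ⟨hne, Or.inl ((hv i hi).trans (hv j hj).symm)⟩ hij

theorem AlgWins.disjoint_colorsOn (h : AlgWins G w k σ) (hs : LegalPlay G w s n)
    {a b c d : ℕ} (hb : b ≤ n) (hd : d ≤ n) (u v : V) (hu : ∀ i ∈ Finset.Ico a b, s i = u)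
    (hv : ∀ i ∈ Finset.Ico c d, s i = v) (huv : G.Adj u v) :
    Disjoint (colorsOn σ s a b) (colorsOn σ s c d) := by
  rw [Finset.disjoint_left]
  intro x hx hx'
  obtain ⟨i, hi, rfl⟩ := Finset.mem_image.mp hx
  obtain ⟨j, hj, hij⟩ := Finset.mem_image.mp hx'
  have hadj : G.Adj (s i) (s j) := by rwa [hu i hi, hv j hj]
  have hi' := Finset.mem_Ico.mp hi
  have hj' := Finset.mem_Ico.mp hj
  refine (h n s hs).2 i j (by omega) (by omega) ⟨?_, Or.inr hadj⟩ hij.symm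
  rintro rfl
  exact hadj.ne rfl

end AlgWins

theorem colorsOn_congr {V : Type*} (σ : List V → ℕ) {s t : ℕ → V} {a b : ℕ}
    (h : ∀ j < b, s j = t j) : colorsOn σ s a b = colorsOn σ t a b := by
  refine Finset.image_congr fun i hi => colorOf_congr σ fun j hj => h j ?_
  have := Finset.mem_Ico.mp hi
  omega

theorem le_of_algWins_P5sq {w k : ℕ} {σ : List (Fin 5) → ℕ} (h : AlgWins P5sq w k σ) :
    5 * (w / 2) ≤ 2 * k := by
  generalize hm : w / 2 = m
  have hw : 2 * m ≤ w := by omega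
  have v0 : ∀ a b, ∀ i ∈ Finset.Ico 0 m, blockPlay m a b i = 0 := by
    intro a b i hi
    rw [Finset.mem_Ico] at hi
    rw [blockPlay, if_pos hi.2]
  have v4 : ∀ a b, ∀ i ∈ Finset.Ico m (2 * m), blockPlay m a b i = 4 := by
    intro a b i hi
    rw [Finset.mem_Ico] at hi
    rw [blockPlay, if_neg (by omega), if_pos hi.2]
  have va : ∀ a b, ∀ i ∈ Finset.Ico (2 * m) (3 * m), blockPlay m a b i = a := by
    intro a b i hi
    rw [Finset.mem_Ico] at hi
    rw [blockPlay, if_neg (by omega), if_neg (by omega), if_pos hi.2]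
  have vb : ∀ a b, ∀ i ∈ Finset.Ico (3 * m) (4 * m), blockPlay m a b i = b := by
    intro a b i hi
    rw [Finset.mem_Ico] at hi
    rw [blockPlay, if_neg (by omega), if_neg (by omega), if_neg (by omega)]
  have hs := legalPlay_blockPlay_center hw
  have ht := legalPlay_blockPlay_sides hw
  set s := blockPlay m 2 2
  set t := blockPlay m 1 3
  have hst : ∀ j < 2 * m, s j = t j := by
    intro j hj
    simp only [s, t, blockPlay, hj, if_true]
  have e0 : colorsOn σ s 0 m = colorsOn σ t 0 m :=
    colorsOn_congr σ fun j hj => hst j (by omega)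
  have e4 : colorsOn σ s m (2 * m) = colorsOn σ t m (2 * m) := colorsOn_congr σ hst
  have center : (colorsOn σ s 0 m ∪ colorsOn σ s m (2 * m)).card + m ≤ k := by
    have hd : Disjoint (colorsOn σ s 0 m ∪ colorsOn σ s m (2 * m))
        (colorsOn σ s (2 * m) (3 * m)) := by
      rw [Finset.disjoint_union_left]
      exact ⟨h.disjoint_colorsOn hs (by omega) le_rfl 0 2 (v0 _ _) (va _ _)
          (by rw [P5sq_adj]; decide),
        h.disjoint_colorsOn hs (by omega) le_rfl 4 2 (v4 _ _) (va _ _)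
          (by rw [P5sq_adj]; decide)⟩
    have hsub := Finset.card_le_card (Finset.union_subset (Finset.union_subset
      (h.colorsOn_subset hs (a := 0) (b := m) (by omega))
      (h.colorsOn_subset hs (a := m) (b := 2 * m) (by omega)))
      (h.colorsOn_subset hs (a := 2 * m) (b := 3 * m) le_rfl))
    rw [Finset.card_union_of_disjoint hd, h.card_colorsOn hs le_rfl 2 (va _ _),
      Finset.card_range] at hsub
    omega
  have sides : (colorsOn σ t 0 m ∩ colorsOn σ t m (2 * m)).card + 2 * m ≤ k := by
    have d1 := h.disjoint_colorsOn ht (by omega) (by omega) 0 1 (v0 _ _) (va _ _)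
      (by rw [P5sq_adj]; decide)
    have d2 := h.disjoint_colorsOn ht (by omega) le_rfl 4 3 (v4 _ _) (vb _ _)
      (by rw [P5sq_adj]; decide)
    have d3 := h.disjoint_colorsOn ht (by omega) le_rfl 1 3 (va _ _) (vb _ _)
      (by rw [P5sq_adj]; decide)
    have hd : Disjoint (colorsOn σ t 0 m ∩ colorsOn σ t m (2 * m))
        (colorsOn σ t (2 * m) (3 * m) ∪ colorsOn σ t (3 * m) (4 * m)) := by
      rw [Finset.disjoint_union_right]
      exact ⟨d1.mono_left Finset.inter_subset_left, d2.mono_left Finset.inter_subset_right⟩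
    have hsub := Finset.card_le_card (Finset.union_subset ((Finset.inter_subset_left
      (s₂ := colorsOn σ t m (2 * m))).trans (h.colorsOn_subset ht (a := 0) (b := m) (by omega)))
      (Finset.union_subset (h.colorsOn_subset ht (a := 2 * m) (b := 3 * m) (by omega))
        (h.colorsOn_subset ht (a := 3 * m) (b := 4 * m) le_rfl)))
    rw [Finset.card_union_of_disjoint hd, Finset.card_union_of_disjoint d3,
      h.card_colorsOn ht (by omega) 1 (va _ _), h.card_colorsOn ht le_rfl 3 (vb _ _),
      Finset.card_range] at hsub
    omega
  have hcard := Finset.card_union_add_card_inter (colorsOn σ s 0 m) (colorsOn σ s m (2 * m))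
  rw [h.card_colorsOn hs (by omega) 0 (v0 _ _), h.card_colorsOn hs (by omega) 4 (v4 _ _)]
    at hcard
  rw [← e0, ← e4] at sides
  omega

/-- For every positive integer `w`, `(5/2)·⌊w/2⌋ ≤ f(w, P₅²) ≤ (5w + 2)/4`;
consequently, when `w` is even, `f(w, P₅²) = ⌈(5/4)·w⌉`. -/
theorem gameValue_P5sq (w : ℕ) (hw : 0 < w) :
    ((5 / 2 : ℚ) * ((w / 2 : ℕ) : ℚ) ≤ (gameValue P5sq w : ℚ) ∧
      (gameValue P5sq w : ℚ) ≤ (5 * w + 2) / 4) ∧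
    (Even w → (gameValue P5sq w : ℚ) = (⌈(5 / 4 : ℚ) * w⌉ : ℚ)) := by
  have upper : gameValue P5sq w ≤ (5 * w + 2) / 4 := Nat.sInf_le (exists_algWins_P5sq w)
  have lower : 5 * (w / 2) ≤ 2 * gameValue P5sq w := by
    obtain ⟨σ, hσ⟩ : ∃ σ, AlgWins P5sq w (gameValue P5sq w) σ :=
      Nat.sInf_mem (s := {k | ∃ σ, AlgWins P5sq w k σ}) ⟨_, exists_algWins_P5sq w⟩
    exact le_of_algWins_P5sq hσ
  have upper' : 4 * gameValue P5sq w ≤ 5 * w + 2 := by omega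
  have upperQ : (4 * gameValue P5sq w : ℚ) ≤ 5 * w + 2 := by exact_mod_cast upper'
  have lowerQ : (5 * (w / 2 : ℕ) : ℚ) ≤ 2 * gameValue P5sq w := by exact_mod_cast lower
  refine ⟨⟨by linarith, by linarith⟩, ?_⟩
  rintro ⟨m, rfl⟩
  have hm : (m + m) / 2 = m := by omega
  rw [hm] at lowerQ
  have hceil : ⌈(5 / 4 : ℚ) * ((m + m : ℕ) : ℚ)⌉ = (gameValue P5sq (m + m) : ℤ) := by
    rw [Int.ceil_eq_iff]
    push_cast at upperQ ⊢
    constructor <;> linarith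
  rw [hceil]
  norm_cast
end

section
/- For every positive integer w, h(w) ≤ 2w − 1; that is, in the online interval coloring game on the real line of width w, the greedy algorithm guarantees that at most 2w − 1 colors are used. -/
/-- The graph `𝔾` on the real line: vertices are the real numbers, with `u` and `v`
adjacent if and only if they are distinct and `|u - v| < 1`.  The online interval
coloring game on the real line of width `w` has value `h(w) = f(w, 𝔾)`. -/
def lineGraph : SimpleGraph ℝ := SimpleGraph.fromRel (fun u v => |u - v| < 1)

/-- The color of the `i`-th token of the play `s` under first-fit coloring: the least color
not used on an earlier adjacent token. -/
noncomputable def greedyColor {V : Type*} (G : SimpleGraph V) (s : ℕ → V) (i : ℕ) : ℕ :=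
  sInf {c | ∀ j, ∀ _ : j < i, TokenAdj G s j i → greedyColor G s j ≠ c}
termination_by i

theorem greedyColor_congr {V : Type*} (G : SimpleGraph V) {s t : ℕ → V} {i : ℕ}
    (h : ∀ j ≤ i, s j = t j) : greedyColor G s i = greedyColor G t i := by
  induction i using Nat.strong_induction_on with
  | _ i ih =>
    rw [greedyColor, greedyColor]
    congr 1
    ext c
    refine forall_congr' fun j => forall_congr' fun hj => ?_
    rw [ih j hj fun m hm => h m (hm.trans hj.le), TokenAdj, TokenAdj, h j hj.le, h i le_rfl]

/-- The online strategy that colors the last token of a history by first fit. -/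
noncomputable def greedyStrategy {V : Type*} (G : SimpleGraph V) (v : V) (l : List V) : ℕ :=
  greedyColor G (fun j => l.getD j v) (l.length - 1)

theorem colorOf_greedyStrategy {V : Type*} (G : SimpleGraph V) (v : V) (s : ℕ → V) (i : ℕ) :
    colorOf (greedyStrategy G v) s i = greedyColor G s i := by
  rw [colorOf, greedyStrategy, List.length_ofFn, Nat.add_sub_cancel]
  refine greedyColor_congr G fun j hj => ?_
  have hj' : j < i + 1 := by lia
  simp only [List.getD_eq_getElem?_getD, List.getElem?_ofFn, hj', dif_pos, Option.getD_some]

theorem TokenAdj.symm {V : Type*} {G : SimpleGraph V} {s : ℕ → V} {i j : ℕ}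
    (h : TokenAdj G s i j) : TokenAdj G s j i :=
  ⟨h.1.symm, h.2.imp Eq.symm SimpleGraph.Adj.symm⟩

theorem exists_not_mem_image_lt {N : Finset ℕ} {f : ℕ → ℕ} {k : ℕ} (hN : N.card < k) :
    ∃ c < k, ∀ j ∈ N, f j ≠ c := by
  obtain ⟨c, hc, hcN⟩ := Finset.exists_mem_notMem_of_card_lt_card
    (s := N.image f) (t := Finset.range k)
    (by simpa using Finset.card_image_le.trans_lt hN)
  exact ⟨c, Finset.mem_range.1 hc, fun j hj h => hcN (Finset.mem_image.2 ⟨j, hj, h⟩)⟩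

theorem greedyColor_ne {V : Type*} (G : SimpleGraph V) {s : ℕ → V} {i j : ℕ}
    (h : TokenAdj G s i j) : greedyColor G s i ≠ greedyColor G s j := by
  wlog hij : i < j generalizing i j
  · exact (this h.symm (lt_of_le_of_ne (not_lt.1 hij) h.1.symm)).symm
  obtain ⟨c, -, hc⟩ := exists_not_mem_image_lt (f := greedyColor G s)
    (Nat.lt_succ_self (Finset.range j).card)
  have hmem := Nat.sInf_mem (s := {c | ∀ m, ∀ _ : m < j, TokenAdj G s m j →
    greedyColor G s m ≠ c}) ⟨c, fun m hm _ => hc m (Finset.mem_range.2 hm)⟩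
  rw [greedyColor.eq_1 G s j]
  exact hmem i hij h

theorem greedyColor_lt {V : Type*} (G : SimpleGraph V) {s : ℕ → V} {i k : ℕ} {N : Finset ℕ}
    (hN : ∀ j < i, TokenAdj G s j i → j ∈ N) (hk : N.card < k) : greedyColor G s i < k := by
  obtain ⟨c, hck, hc⟩ := exists_not_mem_image_lt (f := greedyColor G s) hk
  rw [greedyColor]
  refine lt_of_le_of_lt (Nat.sInf_le ?_) hck
  exact fun j hj hji => hc j (hN j hj hji)

theorem tokenAdj_lineGraph_iff {s : ℕ → ℝ} {i j : ℕ} :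
    TokenAdj lineGraph s i j ↔ i ≠ j ∧ |s i - s j| < 1 := by
  rw [TokenAdj, lineGraph, SimpleGraph.fromRel_adj, abs_sub_comm (s j) (s i), or_self]
  refine and_congr_right fun _ => ⟨?_, fun h => ?_⟩
  · rintro (h | h)
    · simp [h]
    · exact h.2
  · by_cases hs : s i = s j
    · exact Or.inl hs
    · exact Or.inr ⟨hs, h⟩

/-- In a legal play of width `w`, every clique of tokens has at most `w` elements. -/
theorem LegalPlay.card_le {V : Type*} {G : SimpleGraph V} {w n : ℕ} {s : ℕ → V}
    (h : LegalPlay G w s n) {C : Finset ℕ} (hn : ∀ i ∈ C, i < n)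
    (hC : ∀ i ∈ C, ∀ j ∈ C, i ≠ j → TokenAdj G s i j) : C.card ≤ w := by
  obtain ⟨φ, hφ, hproper⟩ := h
  refine (Finset.card_le_card_of_injOn (t := Finset.range w) φ ?_ ?_).trans_eq
    (Finset.card_range w)
  · exact fun i hi => Finset.mem_coe.2 (Finset.mem_range.2 (hφ i (hn i hi)))
  · intro i hi j hj hij
    by_contra hne
    exact hproper i j (hn i hi) (hn j hj) (hC i hi j hj hne) hij

open Classical in
theorem LegalPlay.greedyColor_lineGraph_lt {w n : ℕ} {s : ℕ → ℝ}
    (h : LegalPlay lineGraph w s n) {i : ℕ} (hi : i < n) :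
    greedyColor lineGraph s i < 2 * w - 1 := by
  set L := (Finset.range i).filter fun j => s i - 1 < s j ∧ s j ≤ s i with hL
  set R := (Finset.range i).filter fun j => s i ≤ s j ∧ s j < s i + 1 with hR
  have hLw : (insert i L).card ≤ w := by
    refine h.card_le (fun j hj => by simp [hL] at hj; lia) fun a ha b hb hab => ?_
    have haux : ∀ c ∈ insert i L, s i - 1 < s c ∧ s c ≤ s i := by
      intro c hc
      rcases Finset.mem_insert.1 hc with rfl | hc
      · exact ⟨by linarith, le_rfl⟩
      · exact (Finset.mem_filter.1 hc).2
    have := haux a ha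
    have := haux b hb
    exact tokenAdj_lineGraph_iff.2 ⟨hab, abs_lt.2 ⟨by linarith, by linarith⟩⟩
  have hRw : (insert i R).card ≤ w := by
    refine h.card_le (fun j hj => by simp [hR] at hj; lia) fun a ha b hb hab => ?_
    have haux : ∀ c ∈ insert i R, s i ≤ s c ∧ s c < s i + 1 := by
      intro c hc
      rcases Finset.mem_insert.1 hc with rfl | hc
      · exact ⟨le_rfl, by linarith⟩
      · exact (Finset.mem_filter.1 hc).2
    have := haux a ha
    have := haux b hb
    exact tokenAdj_lineGraph_iff.2 ⟨hab, abs_lt.2 ⟨by linarith, by linarith⟩⟩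
  rw [Finset.card_insert_of_notMem (by simp [hL])] at hLw
  rw [Finset.card_insert_of_notMem (by simp [hR])] at hRw
  refine greedyColor_lt lineGraph (N := L ∪ R) (fun j hj hji => ?_) ?_
  · obtain ⟨-, hd⟩ := tokenAdj_lineGraph_iff.1 hji
    obtain ⟨h₁, h₂⟩ := abs_lt.1 hd
    rcases le_total (s j) (s i) with hs | hs
    · exact Finset.mem_union_left _
        (Finset.mem_filter.2 ⟨Finset.mem_range.2 hj, by linarith, hs⟩)
    · exact Finset.mem_union_right _
        (Finset.mem_filter.2 ⟨Finset.mem_range.2 hj, hs, by linarith⟩)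
  · have := Finset.card_union_le L R
    lia

theorem algWins_greedyStrategy_lineGraph (w : ℕ) :
    AlgWins lineGraph w (2 * w - 1) (greedyStrategy lineGraph 0) := by
  intro n s h
  simp only [colorOf_greedyStrategy]
  exact ⟨fun i hi => h.greedyColor_lineGraph_lt hi,
    fun i j _ _ hij => greedyColor_ne lineGraph hij⟩

/-- For every positive integer `w`, `h(w) ≤ 2w - 1`: in the online interval coloring game
on the real line of width `w`, the greedy algorithm uses at most `2w - 1` colors. -/
theorem lineGame_upper (w : ℕ) (hw : 0 < w) :
    gameValue lineGraph w ≤ 2 * w - 1 := by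
  exact Nat.sInf_le ⟨_, algWins_greedyStrategy_lineGraph w⟩
end
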